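/- Let P = ⊗_{j=1}^n A_j ∈ 𝒫ₙ \ {I^{⊗n}}, U = R(P), and let P_r = ⊗_{j=1}^n B_j and P_s = ⊗_{j=1}^n C_j be n-qubit Pauli matrices with P_r ≠ P_s (equivalently, B_k ≠ C_k for some k). Then Tr(P_r U P_s U†) = (i√2/4)·∏_{j=1}^n Tr(B_j C_j A_j) − (i√2/4)·∏_{j=1}^n Tr(C_j B_j A_j). -/

import Mathlib

open Matrix Complex

/-- The four single-qubit Pauli matrices I, X, Y, Z. -/
noncomputable def pauli : Fin 4 → Matrix (Fin 2) (Fin 2) ℂ :=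
  ![1, !![0, 1; 1, 0], !![0, -Complex.I; Complex.I, 0], !![1, 0; 0, -1]]

/-- The n-qubit Pauli matrix A₁ ⊗ ⋯ ⊗ Aₙ (Kronecker product realized entrywise
on the index type `Fin n → Fin 2`). -/
noncomputable def nPauli {n : ℕ} (A : Fin n → Fin 4) :
    Matrix (Fin n → Fin 2) (Fin n → Fin 2) ℂ :=
  fun x y => ∏ j, pauli (A j) (x j) (y j)

/-- R(P) = ½(1+e^{iπ/4})·I + ½(1−e^{iπ/4})·P. -/
noncomputable def RP {n : ℕ} (A : Fin n → Fin 4) :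
    Matrix (Fin n → Fin 2) (Fin n → Fin 2) ℂ :=
  ((1 + Complex.exp (Complex.I * Real.pi / 4)) / 2) • 1 +
    ((1 - Complex.exp (Complex.I * Real.pi / 4)) / 2) • nPauli A

/-- The channel representation: Û_{rs} = (1/2ⁿ)·Tr(P_r U P_s U†). -/
noncomputable def chanRep {n : ℕ} (U : Matrix (Fin n → Fin 2) (Fin n → Fin 2) ℂ) :
    Matrix (Fin n → Fin 4) (Fin n → Fin 4) ℂ :=
  fun r s => (1 / 2 ^ n : ℂ) * (nPauli r * U * nPauli s * Uᴴ).trace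

/-- The Kronecker product of a family of matrices, realized entrywise on tuples of indices. -/
def piKronecker {ι κ R : Type*} [Fintype ι] [CommSemiring R] (M : ι → Matrix κ κ R) :
    Matrix (ι → κ) (ι → κ) R :=
  fun x y => ∏ j, M j (x j) (y j)

theorem piKronecker_mul {ι κ R : Type*} [Fintype ι] [DecidableEq ι] [Fintype κ] [CommSemiring R]
    (M N : ι → Matrix κ κ R) :
    piKronecker M * piKronecker N = piKronecker fun j => M j * N j := by
  ext x y
  simp only [piKronecker, Matrix.mul_apply, ← Finset.prod_mul_distrib, Fintype.prod_sum]

theorem trace_piKronecker {ι κ R : Type*} [Fintype ι] [DecidableEq ι] [Fintype κ] [CommSemiring R]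
    (M : ι → Matrix κ κ R) : (piKronecker M).trace = ∏ j, (M j).trace := by
  simp only [piKronecker, Matrix.trace, Matrix.diag, Fintype.prod_sum]

theorem nPauli_eq_piKronecker {n : ℕ} (A : Fin n → Fin 4) :
    nPauli A = piKronecker fun j => pauli (A j) := rfl

theorem pauli_conjTranspose (a : Fin 4) : (pauli a)ᴴ = pauli a := by
  fin_cases a <;> ext i j <;> fin_cases i <;> fin_cases j <;> simp [pauli]

theorem nPauli_conjTranspose {n : ℕ} (A : Fin n → Fin 4) : (nPauli A)ᴴ = nPauli A := by
  ext x y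
  simp only [nPauli, Matrix.conjTranspose_apply, star_prod]
  refine Finset.prod_congr rfl fun j _ => ?_
  rw [← Matrix.conjTranspose_apply, pauli_conjTranspose]

theorem trace_pauli_mul_pauli {b c : Fin 4} (h : b ≠ c) : (pauli b * pauli c).trace = 0 := by
  fin_cases b <;> fin_cases c <;> simp_all [pauli, Matrix.trace_fin_two]

theorem pauli_mul_pauli_mul_pauli (a c : Fin 4) :
    pauli a * pauli c * pauli a = pauli c ∨ pauli a * pauli c * pauli a = -pauli c := by
  fin_cases a <;> fin_cases c <;>
    first
    | (left; ext i j; fin_cases i <;> fin_cases j <;>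
        simp [pauli, Matrix.mul_apply]; done)
    | (right; ext i j; fin_cases i <;> fin_cases j <;>
        simp [pauli, Matrix.mul_apply])

theorem trace_nPauli_mul_nPauli {n : ℕ} {B C : Fin n → Fin 4} (h : B ≠ C) :
    (nPauli B * nPauli C).trace = 0 := by
  obtain ⟨k, hk⟩ := Function.ne_iff.mp h
  simp only [nPauli_eq_piKronecker, piKronecker_mul, trace_piKronecker]
  exact Finset.prod_eq_zero (Finset.mem_univ k) (trace_pauli_mul_pauli hk)

theorem trace_nPauli_mul_conj_nPauli {n : ℕ} (A : Fin n → Fin 4) {B C : Fin n → Fin 4}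
    (h : B ≠ C) : (nPauli B * nPauli A * nPauli C * nPauli A).trace = 0 := by
  obtain ⟨k, hk⟩ := Function.ne_iff.mp h
  simp only [nPauli_eq_piKronecker, piKronecker_mul, trace_piKronecker]
  refine Finset.prod_eq_zero (Finset.mem_univ k) ?_
  rw [mul_assoc, mul_assoc, ← mul_assoc (pauli (A k))]
  obtain h | h := pauli_mul_pauli_mul_pauli (A k) (C k) <;>
    simp [h, trace_pauli_mul_pauli hk]

theorem trace_nPauli_mul_mul {n : ℕ} (A B C : Fin n → Fin 4) :
    (nPauli A * nPauli B * nPauli C).trace =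
      ∏ j, (pauli (A j) * pauli (B j) * pauli (C j)).trace := by
  simp only [nPauli_eq_piKronecker, piKronecker_mul, trace_piKronecker]

theorem exp_I_mul_pi_div_four :
    Complex.exp (Complex.I * Real.pi / 4) = Real.sqrt 2 / 2 + Real.sqrt 2 / 2 * Complex.I := by
  have h : Complex.I * Real.pi / 4 = ((Real.pi / 4 : ℝ) : ℂ) * Complex.I := by
    push_cast
    ring
  rw [h, Complex.exp_mul_I, ← Complex.ofReal_cos, ← Complex.ofReal_sin, Real.cos_pi_div_four,
    Real.sin_pi_div_four]
  push_cast
  ring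

theorem trace_mul_conj_smul_one_add_smul {ι : Type*} [Fintype ι] [DecidableEq ι]
    {P Q R : Matrix ι ι ℂ} (hP : Pᴴ = P) (a b : ℂ) :
    (Q * (a • 1 + b • P) * R * (a • 1 + b • P)ᴴ).trace =
      a * star a * (Q * R).trace + a * star b * (Q * R * P).trace +
        b * star a * (R * Q * P).trace + b * star b * (Q * P * R * P).trace := by
  have h : (R * Q * P).trace = (Q * P * R).trace := by
    rw [mul_assoc, Matrix.trace_mul_comm]
  rw [h]
  simp only [Matrix.conjTranspose_add, Matrix.conjTranspose_smul, Matrix.conjTranspose_one, hP,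
    mul_add, add_mul, Matrix.mul_smul, Matrix.smul_mul, mul_one, Matrix.trace_add,
    Matrix.trace_smul, smul_eq_mul]
  ring

/-- off-diagonal trace formula. -/
theorem trace_PrU_PsU_dagger_offdiag {n : ℕ} (A B C : Fin n → Fin 4) (hA : A ≠ 0)
    (hBC : B ≠ C) :
    (nPauli B * RP A * nPauli C * (RP A)ᴴ).trace =
      (Complex.I * Real.sqrt 2 / 4) * ∏ j, (pauli (B j) * pauli (C j) * pauli (A j)).trace -
        (Complex.I * Real.sqrt 2 / 4) * ∏ j, (pauli (C j) * pauli (B j) * pauli (A j)).trace := by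
  have hs : (Real.sqrt 2 : ℂ) ^ 2 = 2 := by
    rw [← Complex.ofReal_pow, Real.sq_sqrt zero_le_two, Complex.ofReal_ofNat]
  rw [RP, trace_mul_conj_smul_one_add_smul (nPauli_conjTranspose A), trace_nPauli_mul_nPauli hBC,
    trace_nPauli_mul_conj_nPauli A hBC, trace_nPauli_mul_mul, trace_nPauli_mul_mul,
    exp_I_mul_pi_div_four]
  generalize (∏ j, (pauli (B j) * pauli (C j) * pauli (A j)).trace) = p
  generalize (∏ j, (pauli (C j) * pauli (B j) * pauli (A j)).trace) = q
  simp only [star_div₀, star_add, star_sub, star_mul', star_one, star_ofNat, Complex.star_def,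
    Complex.conj_ofReal, Complex.conj_I]
  linear_combination (p + q) * (-1 / 16) * ((1 - Complex.I ^ 2) * hs - 2 * Complex.I_sq)
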